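/- Let q not be a root of unity and let R1 = (I1,I2,I3) on V1 and R2 = (I1',I2',I3') on V2 be classical irreducible representations of AW_q(A1,A2,A3), both of dimension N+1, such that the eigenvalues of I3 are −i·[μ1]_q, …, −i·[μ1−N]_q and the eigenvalues of I3' are −i·[μ2]_q, …, −i·[μ2−N]_q for some μ1, μ2 ∈ ℂ. Then R1 and R2 are equivalent (i.e. there exists a linear isomorphism S : V1 → V2 with S∘I_k = I_k'∘S for k = 1,2,3) if and only if [μ1 − N/2]_q = [μ2 − N/2]_q. -/

import Mathlib

noncomputable section

/-- `q^λ := exp (λ·L)`, where `L` is a fixed logarithm of `q` (so `q = exp L` and the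
fixed square root is `q^{1/2} = exp (L/2) = qp L (1/2)`). -/
def qp (L lam : ℂ) : ℂ := Complex.exp (lam * L)

/-- The `q`-number `[λ]_q = (q^λ − q^{−λ})/(q − q⁻¹)`. -/
def qn (L lam : ℂ) : ℂ :=
  (qp L lam - qp L (-lam)) / (Complex.exp L - (Complex.exp L)⁻¹)

variable {V : Type*} [AddCommGroup V] [Module ℂ V]

/-- A representation of `AW_q(A1,A2,A3)` on `V`: a triple of endomorphisms satisfying the
Askey–Wilson `q`-commutation relations. -/
def IsAWRep (L A1 A2 A3 : ℂ) (I1 I2 I3 : Module.End ℂ V) : Prop :=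
  qp L (1/2) • (I1 * I2) - qp L (-(1/2)) • (I2 * I1) = I3 + A3 • (1 : Module.End ℂ V) ∧
  qp L (1/2) • (I2 * I3) - qp L (-(1/2)) • (I3 * I2) = I1 + A1 • (1 : Module.End ℂ V) ∧
  qp L (1/2) • (I3 * I1) - qp L (-(1/2)) • (I1 * I3) = I2 + A2 • (1 : Module.End ℂ V)

/-- Irreducibility: the only subspaces invariant under `I1, I2, I3` are `⊥` and `⊤`. -/
def IsIrreducibleRep (I1 I2 I3 : Module.End ℂ V) : Prop :=
  ∀ W : Submodule ℂ V,
    Submodule.map I1 W ≤ W → Submodule.map I2 W ≤ W → Submodule.map I3 W ≤ W →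
      W = ⊥ ∨ W = ⊤

/-- Classical: none of `±2/(q−q⁻¹)`, `±1/(q^{1/2}−q^{−1/2})` is an eigenvalue of `I3`. -/
def IsClassicalRep (L : ℂ) (I3 : Module.End ℂ V) : Prop :=
  ∀ ε : ℂ, ε = 1 ∨ ε = -1 →
    ¬ Module.End.HasEigenvalue I3 (2 * ε / (Complex.exp L - (Complex.exp L)⁻¹)) ∧
    ¬ Module.End.HasEigenvalue I3 (ε / (qp L (1/2) - qp L (-(1/2))))

/-- The raising shift operator `O_λ`.  (When `A1 = A2 = 0` the coefficient of `I3`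
vanishes, giving `O_λ = i·I2 + q^{−λ+1/2}·I1` for every `λ`.) -/
def Oop (L A1 A2 lam : ℂ) (I1 I2 I3 : Module.End ℂ V) : Module.End ℂ V :=
  ((-Complex.I * qp L (1/2) * A1 + qp L (-lam) * A2) /
      (qn L lam * (qn L lam - qn L (lam + 1)))) • I3
    + Complex.I • I2 + qp L (-lam + 1/2) • I1

/-- The lowering shift operator `R_λ`.  (When `A1 = A2 = 0` the coefficient of `I3`
vanishes, giving `R_λ = i·I2 − q^{λ+1/2}·I1` for every `λ`.) -/
def Rop (L A1 A2 lam : ℂ) (I1 I2 I3 : Module.End ℂ V) : Module.End ℂ V :=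
  ((-Complex.I * qp L (1/2) * A1 - qp L lam * A2) /
      (qn L lam * (qn L lam - qn L (lam - 1)))) • I3
    + Complex.I • I2 - qp L (lam + 1/2) • I1

/-- The `(i, k)` entry of `I1` in an eigenbasis of `I3` vanishes unless the eigenvalues
satisfy the adjacency equation. -/
lemma AW_entries {n : Type*} [Fintype n] [DecidableEq n] {r s A1 A2 A3 : ℂ} (hrs : r * s = 1)
    {θ : n → ℂ} {X B : Matrix n n ℂ}
    (h1 : r • (X * B) - s • (B * X) = Matrix.diagonal θ + A3 • (1 : Matrix n n ℂ))
    (h2 : r • (B * Matrix.diagonal θ) - s • (Matrix.diagonal θ * B) =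
      X + A1 • (1 : Matrix n n ℂ))
    (h3 : r • (Matrix.diagonal θ * X) - s • (X * Matrix.diagonal θ) =
      B + A2 • (1 : Matrix n n ℂ)) :
    (∀ i k, i ≠ k → (1 - (r * θ k - s * θ i) * (r * θ i - s * θ k)) * X i k = 0) ∧
    (∀ i, (1 - ((r - s) * θ i) ^ 2) * X i i = -(r - s) * θ i * A2 - A1) ∧
    (∀ i, ∑ k, X i k * X k i * ((r ^ 2 + s ^ 2) * θ k - 2 * θ i) =
      θ i + A3 + (r - s) * A2 * X i i) := by
  have hB : ∀ i k, B i k = (r * θ i - s * θ k) * X i k - A2 * (1 : Matrix n n ℂ) i k := by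
    intro i k
    have := congrFun (congrFun h3 i) k
    simp [Matrix.sub_apply, Matrix.smul_apply, Matrix.add_apply] at this
    linear_combination -this
  have hX : ∀ i k, (r * θ k - s * θ i) * B i k = X i k + A1 * (1 : Matrix n n ℂ) i k := by
    intro i k
    have := congrFun (congrFun h2 i) k
    simp [Matrix.sub_apply, Matrix.smul_apply, Matrix.add_apply] at this
    linear_combination this
  refine ⟨fun i k hik => ?_, fun i => ?_, fun i => ?_⟩
  · have := hX i k
    rw [hB, Matrix.one_apply_ne hik] at this
    linear_combination -this
  · have := hX i i
    rw [hB, Matrix.one_apply_eq] at this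
    linear_combination -this
  · have := congrFun (congrFun h1 i) i
    simp only [Matrix.sub_apply, Matrix.smul_apply, Matrix.add_apply, Matrix.mul_apply, hB,
      Matrix.diagonal_apply_eq, Matrix.one_apply_eq, smul_eq_mul, mul_one, mul_sub, sub_mul,
      Finset.sum_sub_distrib, Matrix.one_apply, mul_ite, ite_mul, mul_zero, zero_mul,
      Finset.sum_ite_eq, Finset.sum_ite_eq', Finset.mem_univ, if_true] at this
    have e : ∀ k, X i k * X k i * ((r ^ 2 + s ^ 2) * θ k - 2 * θ i) =
      r * (X i k * (r * θ k * X k i)) - r * (X i k * (s * θ i * X k i))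
      - (s * (r * θ i * X i k * X k i) - s * (s * θ k * X i k * X k i)) := by
      intro k
      linear_combination 2 * X i k * X k i * θ i * hrs
    simp only [e, Finset.sum_sub_distrib, ← Finset.mul_sum]
    linear_combination this

/-- The products of opposite off-diagonal entries of a tridiagonal solution are determined
by its diagonal and the weighted row sums `∑ k, X i k * X k i * c i k`. -/
lemma offdiag_products_eq {N : ℕ} {c : Fin (N + 1) → Fin (N + 1) → ℂ} {f : Fin (N + 1) → ℂ}
    {X Y : Matrix (Fin (N + 1)) (Fin (N + 1)) ℂ}
    (hc : ∀ i k : Fin (N + 1), (k : ℕ) = i + 1 → c i k ≠ 0)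
    (hX : ∀ i k : Fin (N + 1), i ≠ k → (k : ℕ) ≠ i + 1 → (i : ℕ) ≠ k + 1 → X i k = 0)
    (hY : ∀ i k : Fin (N + 1), i ≠ k → (k : ℕ) ≠ i + 1 → (i : ℕ) ≠ k + 1 → Y i k = 0)
    (hd : ∀ i, X i i = Y i i)
    (hsX : ∀ i, ∑ k, X i k * X k i * c i k = f i)
    (hsY : ∀ i, ∑ k, Y i k * Y k i * c i k = f i) :
    ∀ i k, X i k * X k i = Y i k * Y k i := by
  have key : ∀ m : ℕ, ∀ i k : Fin (N + 1), (i : ℕ) = m → (k : ℕ) = m + 1 →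
      X i k * X k i = Y i k * Y k i := by
    intro m
    induction m with
    | zero =>
      intro i k hi hk
      have h0 : ∑ l, (X i l * X l i - Y i l * Y l i) * c i l = 0 := by
        simp only [sub_mul, Finset.sum_sub_distrib, hsX, hsY, sub_self]
      rw [Finset.sum_eq_single k] at h0
      · exact sub_eq_zero.1 ((mul_eq_zero.1 h0).resolve_right (hc i k (by omega)))
      · intro l _ hl
        by_cases hil : i = l
        · subst hil; simp [hd]
        · have hl' : (l : ℕ) ≠ k := fun h => hl (Fin.ext h)
          rw [hX i l hil (by omega) (by omega), hY i l hil (by omega) (by omega)]; simp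
      · simp
    | succ m ih =>
      intro i k hi hk
      have h0 : ∑ l, (X i l * X l i - Y i l * Y l i) * c i l = 0 := by
        simp only [sub_mul, Finset.sum_sub_distrib, hsX, hsY, sub_self]
      rw [Finset.sum_eq_single k] at h0
      · exact sub_eq_zero.1 ((mul_eq_zero.1 h0).resolve_right (hc i k (by omega)))
      · intro l _ hl
        by_cases hil : i = l
        · subst hil; simp [hd]
        · have hl' : (l : ℕ) ≠ k := fun h => hl (Fin.ext h)
          by_cases hlm : (l : ℕ) = m
          · linear_combination c i l * ih l i hlm hi
          · rw [hX i l hil (by omega) (by omega), hY i l hil (by omega) (by omega)]; simp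
      · simp
  intro i k
  by_cases hik : i = k
  · subst hik; simp [hd]
  by_cases h1 : (k : ℕ) = i + 1
  · exact key i i k rfl h1
  by_cases h2 : (i : ℕ) = k + 1
  · linear_combination key k k i rfl h2
  · rw [hX i k hik h1 h2, hY i k hik h1 h2]; simp

/-- Two tridiagonal matrices with nonzero off-diagonals, equal diagonals and equal products of
opposite entries are conjugate by a diagonal matrix. -/
lemma exists_diagonal_conj {N : ℕ} {X Y : Matrix (Fin (N + 1)) (Fin (N + 1)) ℂ}
    (hX : ∀ i k : Fin (N + 1), i ≠ k → (k : ℕ) ≠ i + 1 → (i : ℕ) ≠ k + 1 → X i k = 0)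
    (hY : ∀ i k : Fin (N + 1), i ≠ k → (k : ℕ) ≠ i + 1 → (i : ℕ) ≠ k + 1 → Y i k = 0)
    (hd : ∀ i, X i i = Y i i)
    (hp : ∀ i k, X i k * X k i = Y i k * Y k i)
    (hX0 : ∀ m : Fin N, X m.succ m.castSucc ≠ 0)
    (hY0 : ∀ m : Fin N, Y m.succ m.castSucc ≠ 0) :
    ∃ s : Fin (N + 1) → ℂ, (∀ i, s i ≠ 0) ∧ ∀ i k, Y i k * s k = s i * X i k := by
  let s : Fin (N + 1) → ℂ := Fin.induction (motive := fun _ => ℂ) 1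
    (fun m a => a * Y m.succ m.castSucc / X m.succ m.castSucc)
  have hs : ∀ m : Fin N, s m.succ = s m.castSucc * Y m.succ m.castSucc / X m.succ m.castSucc :=
    fun m => rfl
  have hlow : ∀ i k : Fin (N + 1), (i : ℕ) = k + 1 →
      X i k ≠ 0 ∧ Y i k * s k = s i * X i k := by
    intro i k h
    have hk : (k : ℕ) < N := by omega
    obtain rfl : i = (⟨k, hk⟩ : Fin N).succ := Fin.ext h
    obtain ⟨m, rfl⟩ : ∃ m : Fin N, k = m.castSucc := ⟨⟨k, hk⟩, rfl⟩
    have := hX0 m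
    refine ⟨this, ?_⟩
    change Y m.succ m.castSucc * _ = s m.succ * X m.succ m.castSucc
    rw [hs]
    field_simp
  refine ⟨s, fun i => ?_, fun i k => ?_⟩
  · induction i using Fin.induction with
    | zero => exact one_ne_zero
    | succ m ih => rw [hs]; exact div_ne_zero (mul_ne_zero ih (hY0 m)) (hX0 m)
  · by_cases hik : i = k
    · subst hik; rw [hd, mul_comm]
    by_cases h2 : (i : ℕ) = k + 1
    · exact (hlow i k h2).2
    by_cases h1 : (k : ℕ) = i + 1
    · obtain ⟨h0, h⟩ := hlow k i h1
      apply mul_right_cancel₀ h0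
      linear_combination -(Y i k) * h - s i * hp i k
    · rw [hX i k hik h1 h2, hY i k hik h1 h2]; simp

/-- An irreducible representation has no proper nonzero subspace spanned by part of an
eigenbasis of `I3` and invariant under `I1`. -/
lemma IsIrreducibleRep.exists_entry_ne_zero {ι : Type*} [Fintype ι] [DecidableEq ι]
    {L A1 A2 A3 : ℂ} {I1 I2 I3 : Module.End ℂ V}
    (hirr : IsIrreducibleRep I1 I2 I3) (hrep : IsAWRep L A1 A2 A3 I1 I2 I3)
    (b : Module.Basis ι ℂ V) {θ : ι → ℂ} (hb : ∀ i, I3 (b i) = θ i • b i)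
    (T : Set ι) (hT : T.Nonempty) (hT' : Tᶜ.Nonempty) :
    ∃ i k, i ∉ T ∧ k ∈ T ∧ LinearMap.toMatrixAlgEquiv b I1 i k ≠ 0 := by
  by_contra! hcon
  set W := Submodule.span ℂ (b '' T) with hW
  have h3 : W ≤ W.comap I3 := by
    rw [hW, Submodule.span_le]
    rintro _ ⟨k, hk, rfl⟩
    simp only [Submodule.comap_coe, Set.mem_preimage, SetLike.mem_coe, hb]
    exact Submodule.smul_mem _ _ (Submodule.subset_span ⟨k, hk, rfl⟩)
  have h1 : W ≤ W.comap I1 := by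
    rw [hW, Submodule.span_le]
    rintro _ ⟨k, hk, rfl⟩
    simp only [Submodule.comap_coe, Set.mem_preimage, SetLike.mem_coe]
    rw [Module.Basis.mem_span_image]
    intro i hi
    by_contra hiT
    have := hcon i k hiT hk
    rw [LinearMap.toMatrixAlgEquiv_apply] at this
    exact (Finsupp.mem_support_iff.1 hi) this
  have h2 : W ≤ W.comap I2 := by
    intro v hv
    have e := LinearMap.congr_fun hrep.2.2 v
    simp only [LinearMap.sub_apply, LinearMap.smul_apply, LinearMap.add_apply,
      Module.End.mul_apply, Module.End.one_apply] at e
    rw [Submodule.mem_comap, ← sub_eq_of_eq_add e]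
    exact W.sub_mem (W.sub_mem (W.smul_mem _ (h3 (h1 hv))) (W.smul_mem _ (h1 (h3 hv))))
      (W.smul_mem _ hv)
  obtain ⟨k, hk⟩ := hT
  obtain ⟨i, hi⟩ := hT'
  rcases hirr W (Submodule.map_le_iff_le_comap.2 h1) (Submodule.map_le_iff_le_comap.2 h2)
    (Submodule.map_le_iff_le_comap.2 h3) with h | h
  · have : b k ∈ W := Submodule.subset_span ⟨k, hk, rfl⟩
    rw [h, Submodule.mem_bot] at this
    exact b.ne_zero k this
  · have : b i ∈ W := h ▸ Submodule.mem_top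
    rw [Module.Basis.mem_span_image, Module.Basis.repr_self,
      Finsupp.support_single i one_ne_zero] at this
    exact hi (this (by simp))

lemma exists_eigenbasis {N : ℕ} {f : Module.End ℂ V} (hdim : Module.finrank ℂ V = N + 1)
    {θ : Fin (N + 1) → ℂ} (hθ : Function.Injective θ)
    (h : ∀ i, Module.End.HasEigenvalue f (θ i)) :
    ∃ b : Module.Basis (Fin (N + 1)) ℂ V, ∀ i, f (b i) = θ i • b i := by
  choose v hv using fun i => (h i).exists_hasEigenvector
  refine ⟨basisOfLinearIndependentOfCardEqFinrank
    (Module.End.eigenvectors_linearIndependent' f θ hθ v hv) (by simp [hdim]), fun i => ?_⟩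
  rw [coe_basisOfLinearIndependentOfCardEqFinrank]
  exact (hv i).apply_eq_smul

lemma toMatrixAlgEquiv_eq_diagonal {ι : Type*} [Fintype ι] [DecidableEq ι]
    {f : Module.End ℂ V} (b : Module.Basis ι ℂ V) {θ : ι → ℂ} (hb : ∀ i, f (b i) = θ i • b i) :
    LinearMap.toMatrixAlgEquiv b f = Matrix.diagonal θ := by
  ext i k
  rw [LinearMap.toMatrixAlgEquiv_apply, hb]
  by_cases h : i = k
  · subst h; simp
  · simp [h]

lemma qp_half_mul (L : ℂ) : qp L (1/2) * qp L (-(1/2)) = 1 := by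
  simp [qp, ← Complex.exp_add]

/-- In an eigenbasis of `I3` whose eigenvalues satisfy the adjacency equation only for
neighbouring indices, `I1` is tridiagonal. -/
lemma IsAWRep.tridiagonal {N : ℕ} {L A1 A2 A3 : ℂ} {I1 I2 I3 : Module.End ℂ V}
    (hrep : IsAWRep L A1 A2 A3 I1 I2 I3) (hirr : IsIrreducibleRep I1 I2 I3)
    (b : Module.Basis (Fin (N + 1)) ℂ V) {θ : Fin (N + 1) → ℂ}
    (hb : ∀ i, I3 (b i) = θ i • b i)
    (hadj : ∀ i k : Fin (N + 1), i ≠ k → (k : ℕ) ≠ i + 1 → (i : ℕ) ≠ k + 1 →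
      1 - (qp L (1/2) * θ k - qp L (-(1/2)) * θ i) *
        (qp L (1/2) * θ i - qp L (-(1/2)) * θ k) ≠ 0) :
    (∀ i k : Fin (N + 1), i ≠ k → (k : ℕ) ≠ i + 1 → (i : ℕ) ≠ k + 1 →
      LinearMap.toMatrixAlgEquiv b I1 i k = 0) ∧
    (∀ m : Fin N, LinearMap.toMatrixAlgEquiv b I1 m.succ m.castSucc ≠ 0) ∧
    (∀ i, (1 - ((qp L (1/2) - qp L (-(1/2))) * θ i) ^ 2) * LinearMap.toMatrixAlgEquiv b I1 i i =
      -(qp L (1/2) - qp L (-(1/2))) * θ i * A2 - A1) ∧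
    (∀ i, ∑ k, LinearMap.toMatrixAlgEquiv b I1 i k * LinearMap.toMatrixAlgEquiv b I1 k i *
        ((qp L (1/2) ^ 2 + qp L (-(1/2)) ^ 2) * θ k - 2 * θ i) =
      θ i + A3 + (qp L (1/2) - qp L (-(1/2))) * A2 * LinearMap.toMatrixAlgEquiv b I1 i i) := by
  have hD := toMatrixAlgEquiv_eq_diagonal b hb
  obtain ⟨e1, e2, e3⟩ := hrep
  have E1 := congrArg (LinearMap.toMatrixAlgEquiv b) e1
  have E2 := congrArg (LinearMap.toMatrixAlgEquiv b) e2
  have E3 := congrArg (LinearMap.toMatrixAlgEquiv b) e3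
  simp only [map_add, map_sub, map_smul, map_mul, map_one, hD] at E1 E2 E3
  obtain ⟨F1, F2, F3⟩ := AW_entries (qp_half_mul L) E1 E2 E3
  have tri : ∀ i k : Fin (N + 1), i ≠ k → (k : ℕ) ≠ i + 1 → (i : ℕ) ≠ k + 1 →
      LinearMap.toMatrixAlgEquiv b I1 i k = 0 := fun i k h h1 h2 =>
    (mul_eq_zero.1 (F1 i k h)).resolve_left (hadj i k h h1 h2)
  refine ⟨tri, fun m hm => ?_, F2, F3⟩
  obtain ⟨i, k, hi, hk, hik⟩ := hirr.exists_entry_ne_zero ⟨e1, e2, e3⟩ b hb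
    {k | (k : ℕ) ≤ m} ⟨m.castSucc, by simp⟩ ⟨m.succ, by simp⟩
  simp only [Set.mem_ofPred_eq, not_le] at hi hk
  by_cases h : (i : ℕ) = m + 1 ∧ (k : ℕ) = m
  · obtain rfl : i = m.succ := Fin.ext h.1
    obtain rfl : k = m.castSucc := Fin.ext h.2
    exact hik hm
  · exact hik (tri i k (fun h => by subst h; omega) (by omega) (by omega))

/-- Uniqueness of irreducible representations with a given simple `I3`-spectrum. -/
lemma exists_intertwiner {N : ℕ} {L A1 A2 A3 : ℂ}
    {V1 : Type*} [AddCommGroup V1] [Module ℂ V1] {V2 : Type*} [AddCommGroup V2] [Module ℂ V2]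
    {I1 I2 I3 : Module.End ℂ V1} {J1 J2 J3 : Module.End ℂ V2}
    (hrep1 : IsAWRep L A1 A2 A3 I1 I2 I3) (hirr1 : IsIrreducibleRep I1 I2 I3)
    (hrep2 : IsAWRep L A1 A2 A3 J1 J2 J3) (hirr2 : IsIrreducibleRep J1 J2 J3)
    (hdim1 : Module.finrank ℂ V1 = N + 1) (hdim2 : Module.finrank ℂ V2 = N + 1)
    {θ : Fin (N + 1) → ℂ} (hθ : Function.Injective θ)
    (hI : ∀ i, Module.End.HasEigenvalue I3 (θ i)) (hJ : ∀ i, Module.End.HasEigenvalue J3 (θ i))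
    (hadj : ∀ i k : Fin (N + 1), i ≠ k → (k : ℕ) ≠ i + 1 → (i : ℕ) ≠ k + 1 →
      1 - (qp L (1/2) * θ k - qp L (-(1/2)) * θ i) *
        (qp L (1/2) * θ i - qp L (-(1/2)) * θ k) ≠ 0)
    (hdiag : ∀ i, 1 - ((qp L (1/2) - qp L (-(1/2))) * θ i) ^ 2 ≠ 0)
    (hnext : ∀ i k : Fin (N + 1), (k : ℕ) = i + 1 →
      (qp L (1/2) ^ 2 + qp L (-(1/2)) ^ 2) * θ k - 2 * θ i ≠ 0) :
    ∃ S : V1 ≃ₗ[ℂ] V2,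
      (∀ v : V1, S (I1 v) = J1 (S v)) ∧
      (∀ v : V1, S (I2 v) = J2 (S v)) ∧
      (∀ v : V1, S (I3 v) = J3 (S v)) := by
  obtain ⟨b, hb⟩ := exists_eigenbasis hdim1 hθ hI
  obtain ⟨c, hc⟩ := exists_eigenbasis hdim2 hθ hJ
  obtain ⟨triX, subX, dX, sX⟩ := hrep1.tridiagonal hirr1 b hb hadj
  obtain ⟨triY, subY, dY, sY⟩ := hrep2.tridiagonal hirr2 c hc hadj
  have hd : ∀ i, LinearMap.toMatrixAlgEquiv b I1 i i = LinearMap.toMatrixAlgEquiv c J1 i i :=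
    fun i => mul_left_cancel₀ (hdiag i) ((dX i).trans (dY i).symm)
  have hp := offdiag_products_eq hnext triX triY hd sX (fun i => by rw [sY, hd])
  obtain ⟨s, hs0, hs⟩ := exists_diagonal_conj triX triY hd hp subX subY
  let S : V1 ≃ₗ[ℂ] V2 := b.equiv (c.isUnitSMul fun i => (hs0 i).isUnit) (Equiv.refl _)
  have hS : ∀ i, S (b i) = s i • c i := fun i => by
    simp [S, Module.Basis.equiv_apply, Module.Basis.isUnitSMul_apply]
  have hS3 : ∀ v, S (I3 v) = J3 (S v) := by
    have : S.toLinearMap ∘ₗ I3 = J3 ∘ₗ S.toLinearMap := b.ext fun i => by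
      simp [hb, hS, hc, smul_comm (θ i)]
    exact LinearMap.congr_fun this
  have hS1 : ∀ v, S (I1 v) = J1 (S v) := by
    have : S.toLinearMap ∘ₗ I1 = J1 ∘ₗ S.toLinearMap := b.ext fun k => by
      have eX := b.sum_repr (I1 (b k))
      have eY := c.sum_repr (J1 (c k))
      simp only [← LinearMap.toMatrixAlgEquiv_apply] at eX eY
      simp only [LinearMap.comp_apply, LinearEquiv.coe_coe, hS, map_smul]
      rw [← eX, ← eY, map_sum, Finset.smul_sum]
      refine Finset.sum_congr rfl fun i _ => ?_
      rw [map_smul, hS, smul_smul, smul_smul, mul_comm _ (s i), ← hs, mul_comm]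
    exact LinearMap.congr_fun this
  refine ⟨S, hS1, fun v => ?_, hS3⟩
  have eI := LinearMap.congr_fun hrep1.2.2 v
  have eJ := LinearMap.congr_fun hrep2.2.2 (S v)
  simp only [LinearMap.sub_apply, LinearMap.smul_apply, LinearMap.add_apply,
    Module.End.mul_apply, Module.End.one_apply] at eI eJ
  rw [← sub_eq_of_eq_add eI, ← sub_eq_of_eq_add eJ]
  simp [hS1, hS3]

lemma qp_ne_zero (L a : ℂ) : qp L a ≠ 0 := Complex.exp_ne_zero _

lemma qp_neg (L a : ℂ) : qp L (-a) = (qp L a)⁻¹ := by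
  simp [qp, Complex.exp_neg]

lemma exp_eq_qp_half_sq (L : ℂ) : Complex.exp L = qp L (1/2) ^ 2 := by
  rw [qp, ← Complex.exp_nat_mul]
  congr 1
  push_cast
  ring

lemma qp_sub_nat_div_two (L a : ℂ) (n : ℕ) :
    qp L (a - (n : ℂ) / 2) = qp L a / qp L (1/2) ^ n := by
  rw [qp, qp, qp, ← Complex.exp_nat_mul, ← Complex.exp_sub]
  congr 1
  ring

lemma qn_sub_nat_div_two (L a : ℂ) (n : ℕ) :
    qn L (a - (n : ℂ) / 2) =
      (qp L a / qp L (1/2) ^ n - qp L (1/2) ^ n / qp L a) /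
        (Complex.exp L - (Complex.exp L)⁻¹) := by
  rw [qn, qp_neg, qp_sub_nat_div_two, inv_div]

lemma qn_sub_nat (L a : ℂ) (n : ℕ) :
    qn L (a - n) = (qp L a / Complex.exp L ^ n - Complex.exp L ^ n / qp L a) /
      (Complex.exp L - (Complex.exp L)⁻¹) := by
  have := qn_sub_nat_div_two L a (2 * n)
  rw [pow_mul, ← exp_eq_qp_half_sq] at this
  rw [← this]
  congr 2
  push_cast
  ring

lemma pow_inj_of_not_root {q : ℂ} (hq0 : q ≠ 0) (hq : ∀ n : ℕ, 0 < n → q ^ n ≠ 1) {i k : ℕ}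
    (h : q ^ i = q ^ k) : i = k := by
  wlog hik : i < k generalizing i k
  · rcases (not_lt.1 hik).eq_or_lt with h' | h'
    · exact h'.symm
    · exact (this h.symm h').symm
  refine absurd ?_ (hq (k - i) (by omega))
  apply mul_left_cancel₀ (pow_ne_zero i hq0)
  rw [← pow_add, Nat.add_sub_cancel' hik.le, h, mul_one]

lemma sub_inv_ne_zero_of_not_root {q : ℂ} (hq0 : q ≠ 0) (hq : ∀ n : ℕ, 0 < n → q ^ n ≠ 1) :
    q - q⁻¹ ≠ 0 := by
  intro h
  apply hq 2 two_pos
  field_simp at h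
  linear_combination h

/-- A classical spectrum avoids the values for which two eigenvalues `-i[μ - j]` collide. -/
lemma IsClassicalRep.qp_sq_ne {N : ℕ} {L μ : ℂ} {I3 : Module.End ℂ V}
    (hq : ∀ n : ℕ, 0 < n → Complex.exp L ^ n ≠ 1) (hclass : IsClassicalRep L I3)
    (h : ∀ j : Fin (N + 1), Module.End.HasEigenvalue I3 (-Complex.I * qn L (μ - (j : ℕ))))
    {n : ℕ} (hn : n ≤ 2 * N + 1) : qp L μ ^ 2 ≠ -Complex.exp L ^ n := by
  intro hx
  have hD := sub_inv_ne_zero_of_not_root (Complex.exp_ne_zero L) hq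
  have hr := qp_ne_zero L (1/2)
  have hq2 := hq 2 two_pos
  have hx0 := qp_ne_zero L μ
  have hev : ∀ m : ℕ, m ≤ N → Module.End.HasEigenvalue I3 (-Complex.I * qn L (μ - (m : ℕ))) :=
    fun m hm => h ⟨m, by omega⟩
  obtain ⟨m, rfl | rfl⟩ := Nat.even_or_odd' n
  · have hm := hev m (by omega)
    rw [qn_sub_nat] at hm
    have hqm : Complex.exp L ^ m ≠ 0 := pow_ne_zero _ (Complex.exp_ne_zero L)
    rw [mul_comm 2 m, pow_mul] at hx
    generalize Complex.exp L ^ m = A at *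
    have hε : (-Complex.I * (qp L μ / A)) ^ 2 = 1 := by
      field_simp
      linear_combination qp L μ ^ 2 * Complex.I_sq - hx
    refine (hclass _ (sq_eq_one_iff.1 hε)).1 ?_
    convert hm using 1
    have : A / qp L μ = -(qp L μ / A) := by
      field_simp
      linear_combination hx
    rw [this]
    ring
  · have hm := hev m (by omega)
    rw [qn_sub_nat] at hm
    have hqm : Complex.exp L ^ m ≠ 0 := pow_ne_zero _ (Complex.exp_ne_zero L)
    rw [pow_succ (Complex.exp L), mul_comm 2 m, pow_mul] at hx
    generalize Complex.exp L ^ m = A at *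
    rw [exp_eq_qp_half_sq] at hx hm hD hq2
    have hcl := fun ε hε => (hclass ε hε).2
    simp only [qp_neg] at hcl
    generalize qp L (1/2) = r at *
    have hε : (-Complex.I * (qp L μ / A) / r) ^ 2 = 1 := by
      field_simp
      linear_combination qp L μ ^ 2 * Complex.I_sq - hx
    refine hcl _ (sq_eq_one_iff.1 hε) ?_
    convert hm using 1
    have e : A / qp L μ = -(qp L μ / A) / r ^ 2 := by
      field_simp
      linear_combination hx
    have hr1 : r - r⁻¹ ≠ 0 := by
      intro h0
      apply hq2
      field_simp at h0
      linear_combination (r ^ 2 + 1) * h0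
    rw [e]
    generalize qp L μ / A = t
    rw [div_eq_iff hr1, mul_div_assoc', div_mul_eq_mul_div, eq_div_iff hD]
    field_simp
    ring

section Spectrum

variable {r x : ℂ} {N : ℕ}

/-- The eigenvalue `-i[μ - j]`, in terms of `r = q^{1/2}` and `x = q^μ`. -/
def specVal (r x : ℂ) (j : ℕ) : ℂ :=
  -Complex.I * ((x / (r ^ 2) ^ j - (r ^ 2) ^ j / x) / (r ^ 2 - (r ^ 2)⁻¹))

lemma specVal_inj (hr : r ≠ 0) (hx0 : x ≠ 0) (hq : ∀ n : ℕ, 0 < n → (r ^ 2) ^ n ≠ 1)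
    (hx : ∀ n : ℕ, n ≤ 2 * N + 1 → x ^ 2 ≠ -(r ^ 2) ^ n) {i k : ℕ} (hi : i ≤ N) (hk : k ≤ N)
    (h : specVal r x i = specVal r x k) : i = k := by
  have hq0 : r ^ 2 ≠ 0 := pow_ne_zero 2 hr
  have hD := sub_inv_ne_zero_of_not_root hq0 hq
  have h' := (div_left_inj' hD).1 (mul_left_cancel₀ (neg_ne_zero.2 Complex.I_ne_zero) h)
  have hp : ((r ^ 2) ^ k - (r ^ 2) ^ i) * (x ^ 2 + (r ^ 2) ^ (i + k)) = 0 := by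
    have hA := pow_ne_zero i hq0
    have hB := pow_ne_zero k hq0
    rw [pow_add]
    generalize (r ^ 2) ^ i = A at *
    generalize (r ^ 2) ^ k = B at *
    field_simp at h'
    linear_combination h'
  rcases mul_eq_zero.1 hp with h1 | h1
  · exact pow_inj_of_not_root hq0 hq (sub_eq_zero.1 h1).symm
  · exact absurd (eq_neg_of_add_eq_zero_left h1) (hx _ (by omega))

lemma specVal_adjacent (hr : r ≠ 0) (hx0 : x ≠ 0) (hq : ∀ n : ℕ, 0 < n → (r ^ 2) ^ n ≠ 1)
    (hx : ∀ n : ℕ, n ≤ 2 * N + 1 → x ^ 2 ≠ -(r ^ 2) ^ n) {i k : ℕ} (hi : i ≤ N) (hk : k ≤ N)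
    (hik : i ≠ k) (h1 : k ≠ i + 1) (h2 : i ≠ k + 1) :
    1 - (r * specVal r x k - r⁻¹ * specVal r x i) *
      (r * specVal r x i - r⁻¹ * specVal r x k) ≠ 0 := by
  intro h
  have hq0 : r ^ 2 ≠ 0 := pow_ne_zero 2 hr
  have hD := sub_inv_ne_zero_of_not_root hq0 hq
  have hp : ((r ^ 2) ^ i - (r ^ 2) ^ (k + 1)) * ((r ^ 2) ^ (i + 1) - (r ^ 2) ^ k) *
      (r ^ 2 * x ^ 2 + (r ^ 2) ^ (i + k)) * (x ^ 2 + (r ^ 2) ^ (i + k + 1)) = 0 := by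
    have hA := pow_ne_zero i hq0
    have hB := pow_ne_zero k hq0
    unfold specVal at h
    simp only [pow_add, pow_one]
    generalize (r ^ 2) ^ i = A at *
    generalize (r ^ 2) ^ k = B at *
    set u := x / A - A / x with hu
    set w := x / B - B / x with hw
    set D := r ^ 2 - (r ^ 2)⁻¹ with hDdef
    have h' : D ^ 2 + (r ^ 2 + (r ^ 2)⁻¹) * u * w - u ^ 2 - w ^ 2 = 0 := by
      have e : D ^ 2 + (r ^ 2 + (r ^ 2)⁻¹) * u * w - u ^ 2 - w ^ 2 =
          D ^ 2 * (1 - (r * (-Complex.I * (w / D)) - r⁻¹ * (-Complex.I * (u / D))) *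
            (r * (-Complex.I * (u / D)) - r⁻¹ * (-Complex.I * (w / D)))) := by
        field_simp
        linear_combination (r ^ 2 * w - u) * (r ^ 2 * u - w) * Complex.I_sq
      rw [e, h, mul_zero]
    have e : (A - B * r ^ 2) * (A * r ^ 2 - B) * (r ^ 2 * x ^ 2 + A * B) *
        (x ^ 2 + A * B * r ^ 2) = -(r ^ 4 * x ^ 2 * A ^ 2 * B ^ 2) *
        (D ^ 2 + (r ^ 2 + (r ^ 2)⁻¹) * u * w - u ^ 2 - w ^ 2) := by
      rw [hu, hw, hDdef]
      field_simp
      ring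
    rw [e, h', mul_zero]
  rcases mul_eq_zero.1 hp with hp | hp
  · rcases mul_eq_zero.1 hp with hp | hp
    · rcases mul_eq_zero.1 hp with hp | hp
      · exact h2 (pow_inj_of_not_root hq0 hq (sub_eq_zero.1 hp))
      · exact h1 (pow_inj_of_not_root hq0 hq (sub_eq_zero.1 hp)).symm
    · refine hx (i + k - 1) (by omega) (mul_left_cancel₀ hq0 ?_)
      have : (r ^ 2) ^ (i + k) = r ^ 2 * (r ^ 2) ^ (i + k - 1) := by
        rw [← pow_succ']
        congr 1
        omega
      linear_combination hp - this
  · exact hx (i + k + 1) (by omega) (eq_neg_of_add_eq_zero_left hp)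

lemma specVal_next (hr : r ≠ 0) (hx0 : x ≠ 0) (hq : ∀ n : ℕ, 0 < n → (r ^ 2) ^ n ≠ 1)
    (hx : ∀ n : ℕ, n ≤ 2 * N + 1 → x ^ 2 ≠ -(r ^ 2) ^ n) {i : ℕ} (hi : i + 1 ≤ N) :
    (r ^ 2 + r⁻¹ ^ 2) * specVal r x (i + 1) - 2 * specVal r x i ≠ 0 := by
  intro h
  have hq0 : r ^ 2 ≠ 0 := pow_ne_zero 2 hr
  have hD := sub_inv_ne_zero_of_not_root hq0 hq
  have hA := pow_ne_zero i hq0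
  have hp : (1 - (r ^ 2) ^ 2) * (x ^ 2 + (r ^ 2) ^ (2 * i + 2)) = 0 := by
    unfold specVal at h
    rw [pow_add _ (2 * i) 2, mul_comm 2 i, pow_mul _ i 2]
    rw [pow_succ (r ^ 2) i] at h
    generalize (r ^ 2) ^ i = A at *
    set D := r ^ 2 - (r ^ 2)⁻¹
    have e : (1 - (r ^ 2) ^ 2) * (x ^ 2 + A ^ 2 * (r ^ 2) ^ 2) =
        Complex.I * D * (A * r ^ 4 * x) *
        ((r ^ 2 + r⁻¹ ^ 2) * (-Complex.I * ((x / (A * r ^ 2) - A * r ^ 2 / x) / D)) -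
          2 * (-Complex.I * ((x / A - A / x) / D))) := by
      field_simp
      rw [Complex.I_sq]
      ring
    rw [e, h, mul_zero]
  rcases mul_eq_zero.1 hp with hp | hp
  · exact hq 2 two_pos (sub_eq_zero.1 hp).symm
  · exact hx _ (by omega) (eq_neg_of_add_eq_zero_left hp)

/-- The sum of the spectrum determines `x / r ^ N - r ^ N / x`. -/
lemma sum_specVal (hr : r ≠ 0) (hx0 : x ≠ 0) (hq : ∀ n : ℕ, 0 < n → (r ^ 2) ^ n ≠ 1) :
    ∑ j ∈ Finset.range (N + 1), specVal r x j =
      (-Complex.I * (∑ j ∈ Finset.range (N + 1), (r ^ 2) ^ j) / r ^ N /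
        (r ^ 2 - (r ^ 2)⁻¹)) * (x / r ^ N - r ^ N / x) := by
  have hD := sub_inv_ne_zero_of_not_root (pow_ne_zero 2 hr) hq
  have hrefl : ∑ j ∈ Finset.range (N + 1), x / (r ^ 2) ^ j =
      x / (r ^ 2) ^ N * ∑ j ∈ Finset.range (N + 1), (r ^ 2) ^ j := by
    rw [← Finset.sum_range_reflect, Finset.mul_sum]
    refine Finset.sum_congr rfl fun j hj => ?_
    have hj' : j ≤ N := by simpa [Nat.lt_succ_iff] using hj
    rw [show N + 1 - 1 - j = N - j by omega, ← Nat.sub_add_cancel hj', pow_add,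
      Nat.add_sub_cancel]
    field_simp
  simp only [specVal, ← Finset.mul_sum, ← Finset.sum_div, Finset.sum_sub_distrib, hrefl]
  rw [← pow_mul, mul_comm 2 N, pow_mul]
  have hR := pow_ne_zero N hr
  field_simp

lemma geom_sum_ne_zero_of_not_root {q : ℂ} (hq : ∀ n : ℕ, 0 < n → q ^ n ≠ 1) (N : ℕ) :
    ∑ j ∈ Finset.range (N + 1), q ^ j ≠ 0 := by
  intro h
  have := geom_sum_mul q (N + 1)
  rw [h, zero_mul] at this
  exact hq (N + 1) N.succ_pos (sub_eq_zero.1 this.symm)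

lemma specVal_reflect {y : ℂ} (hr : r ≠ 0) (hx0 : x ≠ 0) (hy0 : y ≠ 0)
    (h : x * y = -(r ^ N) ^ 2) {i k : ℕ} (hik : i + k = N) :
    specVal r x i = specVal r y k := by
  obtain rfl : y = -(r ^ N) ^ 2 / x := by
    rw [eq_div_iff hx0, mul_comm, h]
  subst hik
  unfold specVal
  rw [pow_add, ← pow_mul, ← pow_mul, mul_comm 2 i, mul_comm 2 k, pow_mul, pow_mul]
  have hA := pow_ne_zero i hr
  have hB := pow_ne_zero k hr
  congr 2
  field_simp
  ring

end Spectrum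

/-- two classical irreducible `(N+1)`-dimensional representations of
`AW_q(A1,A2,A3)`, with `I3`-spectra `−i[μ1−j]_q` resp. `−i[μ2−j]_q` (`j = 0,…,N`), are
equivalent if and only if `[μ1−N/2]_q = [μ2−N/2]_q`. -/
theorem equivalence_iff_trace (L : ℂ) (hq : ∀ n : ℕ, 0 < n → Complex.exp L ^ n ≠ 1)
    (A1 A2 A3 : ℂ) (N : ℕ)
    {V1 : Type*} [AddCommGroup V1] [Module ℂ V1]
    {V2 : Type*} [AddCommGroup V2] [Module ℂ V2]
    (I1 I2 I3 : Module.End ℂ V1) (J1 J2 J3 : Module.End ℂ V2)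
    (μ1 μ2 : ℂ)
    (hrep1 : IsAWRep L A1 A2 A3 I1 I2 I3)
    (hirr1 : IsIrreducibleRep I1 I2 I3)
    (hclass1 : IsClassicalRep L I3)
    (hdim1 : Module.finrank ℂ V1 = N + 1)
    (hspec1 : ∀ c : ℂ, Module.End.HasEigenvalue I3 c ↔
      ∃ j : Fin (N + 1), c = -Complex.I * qn L (μ1 - (j : ℕ)))
    (hrep2 : IsAWRep L A1 A2 A3 J1 J2 J3)
    (hirr2 : IsIrreducibleRep J1 J2 J3)
    (hclass2 : IsClassicalRep L J3)
    (hdim2 : Module.finrank ℂ V2 = N + 1)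
    (hspec2 : ∀ c : ℂ, Module.End.HasEigenvalue J3 c ↔
      ∃ j : Fin (N + 1), c = -Complex.I * qn L (μ2 - (j : ℕ))) :
    (∃ S : V1 ≃ₗ[ℂ] V2,
      (∀ v : V1, S (I1 v) = J1 (S v)) ∧
      (∀ v : V1, S (I2 v) = J2 (S v)) ∧
      (∀ v : V1, S (I3 v) = J3 (S v))) ↔
    qn L (μ1 - (N : ℂ) / 2) = qn L (μ2 - (N : ℂ) / 2) := by
  have hq0 := qp_ne_zero L (1/2)
  have hx1 := qp_ne_zero L μ1
  have hx2 := qp_ne_zero L μ2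
  have hav1 : ∀ n : ℕ, n ≤ 2 * N + 1 → qp L μ1 ^ 2 ≠ -Complex.exp L ^ n := fun n hn =>
    hclass1.qp_sq_ne hq (fun j => (hspec1 _).2 ⟨j, rfl⟩) hn
  have hav2 : ∀ n : ℕ, n ≤ 2 * N + 1 → qp L μ2 ^ 2 ≠ -Complex.exp L ^ n := fun n hn =>
    hclass2.qp_sq_ne hq (fun j => (hspec2 _).2 ⟨j, rfl⟩) hn
  have hD := sub_inv_ne_zero_of_not_root (Complex.exp_ne_zero L) hq
  have hcl := fun ε hε => (hclass1 ε hε).2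
  have hd := qp_neg L (1/2)
  simp only [qn_sub_nat] at hspec1 hspec2
  simp only [qn_sub_nat_div_two]
  rw [div_left_inj' hD]
  rw [exp_eq_qp_half_sq] at hq hav1 hav2 hD hspec1 hspec2
  rw [hd] at hcl
  change ∀ c, _ ↔ ∃ j : Fin (N + 1), c = specVal _ _ j at hspec1
  change ∀ c, _ ↔ ∃ j : Fin (N + 1), c = specVal _ _ j at hspec2
  have hR := pow_ne_zero N hq0
  constructor
  · rintro ⟨S, -, -, hS⟩
    have hev : ∀ c, Module.End.HasEigenvalue I3 c ↔ Module.End.HasEigenvalue J3 c := by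
      have aux : ∀ c, Module.End.HasEigenvalue I3 c → Module.End.HasEigenvalue J3 c := by
        intro c hc
        obtain ⟨v, hv⟩ := hc.exists_hasEigenvector
        refine Module.End.hasEigenvalue_of_hasEigenvector (x := S v) ⟨?_, ?_⟩
        · rw [Module.End.mem_eigenspace_iff, ← hS, hv.apply_eq_smul, map_smul]
        · simpa using hv.2
      refine fun c => ⟨aux c, fun hc => ?_⟩
      obtain ⟨v, hv⟩ := hc.exists_hasEigenvector
      refine Module.End.hasEigenvalue_of_hasEigenvector (x := S.symm v) ⟨?_, ?_⟩
      · rw [Module.End.mem_eigenspace_iff]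
        apply S.injective
        rw [hS, S.apply_symm_apply, hv.apply_eq_smul, map_smul, S.apply_symm_apply]
      · simpa using hv.2
    have himg : (Finset.range (N + 1)).image (specVal (qp L (1/2)) (qp L μ1)) =
        (Finset.range (N + 1)).image (specVal (qp L (1/2)) (qp L μ2)) := by
      ext c
      have := (hspec1 c).symm.trans ((hev c).trans (hspec2 c))
      simpa [Fin.exists_iff, eq_comm (a := c)] using this
    have hsum := congrArg (fun s : Finset ℂ => ∑ c ∈ s, c) himg
    beta_reduce at hsum
    rw [Finset.sum_image fun i hi k hk h => specVal_inj hq0 hx1 hq hav1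
        (Nat.lt_succ_iff.1 (Finset.mem_range.1 hi)) (Nat.lt_succ_iff.1 (Finset.mem_range.1 hk)) h,
      Finset.sum_image fun i hi k hk h => specVal_inj hq0 hx2 hq hav2
        (Nat.lt_succ_iff.1 (Finset.mem_range.1 hi)) (Nat.lt_succ_iff.1 (Finset.mem_range.1 hk)) h,
      sum_specVal hq0 hx1 hq, sum_specVal hq0 hx2 hq] at hsum
    exact mul_left_cancel₀ (div_ne_zero (div_ne_zero (mul_ne_zero
      (neg_ne_zero.2 Complex.I_ne_zero) (geom_sum_ne_zero_of_not_root hq N)) hR) hD) hsum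
  · intro h
    have hJ : ∀ i : Fin (N + 1),
        Module.End.HasEigenvalue J3 (specVal (qp L (1/2)) (qp L μ1) i) := by
      intro i
      have hprod : (qp L μ1 - qp L μ2) * (qp L μ1 * qp L μ2 + (qp L (1/2) ^ N) ^ 2) = 0 := by
        field_simp at h
        linear_combination h
      rcases mul_eq_zero.1 hprod with h1 | h1
      · rw [sub_eq_zero.1 h1]
        exact (hspec2 _).2 ⟨i, rfl⟩
      · refine (hspec2 _).2 ⟨i.rev, ?_⟩
        exact specVal_reflect hq0 hx1 hx2 (eq_neg_of_add_eq_zero_left h1) (by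
          rw [Fin.val_rev]; omega)
    refine exists_intertwiner hrep1 hirr1 hrep2 hirr2 hdim1 hdim2
      (θ := fun i => specVal (qp L (1/2)) (qp L μ1) i)
      (fun i k hik => Fin.ext (specVal_inj hq0 hx1 hq hav1 i.is_le k.is_le hik))
      (fun i => (hspec1 _).2 ⟨i, rfl⟩) hJ (fun i k hik h1 h2 => ?_) (fun i hi => ?_)
      (fun i k hik => ?_)
    · rw [hd]
      exact specVal_adjacent hq0 hx1 hq hav1 i.is_le k.is_le (fun h => hik (Fin.ext h)) h1 h2
    · rw [hd] at hi
      have hr : qp L (1/2) - (qp L (1/2))⁻¹ ≠ 0 := by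
        intro h0
        rw [h0] at hi
        simp at hi
      refine hcl _ (sq_eq_one_iff.1 (sub_eq_zero.1 hi).symm) ((hspec1 _).2 ⟨i, ?_⟩)
      rw [mul_div_cancel_left₀ _ hr]
    · simp only [hd, hik]
      exact specVal_next hq0 hx1 hq hav1 (by omega)
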